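/- (Theorem 10.1, local coordinate form.) Let n ≥ 3, let U be an open subset of ℝⁿ and g : U → Matrix (Fin n) (Fin n) ℝ a C^∞ map such that g(x) is symmetric and positive definite for every x ∈ U, with Christoffel symbols Γᵏᵢⱼ. Let p₀ ∈ U, let v₀ ∈ ℝⁿ be nonzero, let α = {w ∈ ℝⁿ : Σ_{i,j} g_{ij}(p₀) v₀ⁱ wʲ = 0} be the g(p₀)-orthogonal hyperplane to v₀, let τ₁,…,τ_{n−1} be a basis of α, let b be a symmetric (n−1)×(n−1) real matrix, and let n₀ = v₀ / |v₀|_{g(p₀)} be the g(p₀)-unit vector along v₀. Then there exist an open neighborhood W of 0 in ℝⁿ⁻¹ and a C^∞ map r : W → U such that r(0) = p₀, the vectors ∂r/∂u¹(u),…,∂r/∂uⁿ⁻¹(u) are linearly independent for every u ∈ W, ∂r/∂uⁱ(0) = τᵢ for each i, and for all i, j: b_{ij} = Σ_{a,c} g_{ac}(p₀) n₀ᵃ ( ∂²rᶜ/∂uⁱ∂uʲ(0) + Σ_{d,e} Γᶜ_{de}(p₀) τᵢᵈ τⱼᵉ ); i.e. r parametrizes a hypersurface through p₀ tangent to α whose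 second fundamental form at p₀ with respect to the unit normal n₀ coincides with b. -/

import Mathlib

/-- Christoffel symbols of a metric `g` on an open subset of `ℝⁿ`. -/
noncomputable def christoffel {n : ℕ} (g : (Fin n → ℝ) → Matrix (Fin n) (Fin n) ℝ)
    (x : Fin n → ℝ) (k i j : Fin n) : ℝ :=
  (1 / 2) * ∑ s : Fin n, (g x)⁻¹ k s *
    (fderiv ℝ (fun y => g y s j) x (Pi.single i 1) +
     fderiv ℝ (fun y => g y i s) x (Pi.single j 1) -
     fderiv ℝ (fun y => g y i j) x (Pi.single s 1))

/-- The inner product on `ℝⁿ` defined by a matrix `A`: `⟨x, y⟩_A = Σ_{i,j} A_{ij} xⁱ yʲ`. -/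
def gInner {n : ℕ} (A : Matrix (Fin n) (Fin n) ℝ) (x y : Fin n → ℝ) : ℝ :=
  ∑ i : Fin n, ∑ j : Fin n, A i j * x i * y j

theorem christoffel_comm {n : ℕ} {g : (Fin n → ℝ) → Matrix (Fin n) (Fin n) ℝ} {x : Fin n → ℝ}
    (hg : ∀ᶠ y in nhds x, (g y).IsSymm) (k i j : Fin n) :
    christoffel g x k i j = christoffel g x k j i := by
  have h (a c : Fin n) : fderiv ℝ (fun y => g y a c) x = fderiv ℝ (fun y => g y c a) x :=
    Filter.EventuallyEq.fderiv_eq (hg.mono fun y hy => hy.apply c a)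
  unfold christoffel
  congr 1
  refine Finset.sum_congr rfl fun s _ => ?_
  rw [h s j, h i s, h i j]
  ring

theorem gInner_eq_dotProduct_mulVec {n : ℕ} (A : Matrix (Fin n) (Fin n) ℝ) (x y : Fin n → ℝ) :
    gInner A x y = x ⬝ᵥ A.mulVec y := by
  simp only [gInner, dotProduct, Matrix.mulVec, Finset.mul_sum]
  exact Finset.sum_congr rfl fun i _ => Finset.sum_congr rfl fun j _ => by ring

theorem gInner_self_pos {n : ℕ} {A : Matrix (Fin n) (Fin n) ℝ} (hA : A.PosDef) {x : Fin n → ℝ}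
    (hx : x ≠ 0) : 0 < gInner A x x := by
  simpa [gInner_eq_dotProduct_mulVec] using hA.dotProduct_mulVec_pos hx

section QuadraticMap

variable {E F : Type*} [NormedAddCommGroup E] [NormedSpace ℝ E] [NormedAddCommGroup F]
  [NormedSpace ℝ F]

/-- The map `u ↦ p + A u + (1/2) B(u, u) v`. -/
noncomputable def quadraticMap (p v : F) (A : E →L[ℝ] F) (B : E →L[ℝ] E →L[ℝ] ℝ) (u : E) : F :=
  p + A u + ((1 / 2 : ℝ) * B u u) • v

theorem contDiff_quadraticMap (p v : F) (A : E →L[ℝ] F) (B : E →L[ℝ] E →L[ℝ] ℝ)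
    {k : WithTop ℕ∞} : ContDiff ℝ k (quadraticMap p v A B) := by
  unfold quadraticMap
  fun_prop

theorem fderiv_quadraticMap_apply (p v : F) (A : E →L[ℝ] F) {B : E →L[ℝ] E →L[ℝ] ℝ}
    (hB : ∀ x y, B x y = B y x) (u w : E) :
    fderiv ℝ (quadraticMap p v A B) u w = A w + B u w • v := by
  have hq : HasFDerivAt (fun u => B u u) (B.precompR E u (.id ℝ E) + B.precompL E (.id ℝ E) u) u :=
    B.hasFDerivAt_of_bilinear (hasFDerivAt_id u) (hasFDerivAt_id u)
  have h : HasFDerivAt (quadraticMap p v A B) _ u :=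
    (A.hasFDerivAt.const_add p).add ((hq.const_mul (1 / 2 : ℝ)).smul_const v)
  rw [h.fderiv]
  simp [hB w u]
  ring_nf

end QuadraticMap

/-- **Theorem 10.1 (local coordinate form).**  Given a point `p₀`, a nonzero vector `v₀`, a
basis `τ₁, …, τ_{n−1}` of the `g(p₀)`-orthogonal hyperplane `α` to `v₀` and a symmetric matrix
`b`, there is a smoothly immersed hypersurface `r` through `p₀` tangent to `α` whose coordinate
tangent vectors at `p₀` are the `τᵢ` and whose second fundamental form at `p₀` with respect to
the unit normal `n₀ = v₀/|v₀|` is `b`. -/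
theorem exists_hypersurface_with_second_form {n : ℕ} (hn : 3 ≤ n)
    (U : Set (Fin n → ℝ)) (hU : IsOpen U)
    (g : (Fin n → ℝ) → Matrix (Fin n) (Fin n) ℝ)
    (hsmooth : ∀ i j : Fin n, ContDiffOn ℝ (⊤ : ℕ∞) (fun x => g x i j) U)
    (hsym : ∀ x ∈ U, (g x).IsSymm)
    (hpos : ∀ x ∈ U, (g x).PosDef)
    (p₀ : Fin n → ℝ) (hp₀ : p₀ ∈ U)
    (v₀ : Fin n → ℝ) (hv₀ : v₀ ≠ 0)
    (τ : Fin (n - 1) → Fin n → ℝ)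
    (hτind : LinearIndependent ℝ τ)
    (hτperp : ∀ a : Fin (n - 1), gInner (g p₀) v₀ (τ a) = 0)
    (b : Matrix (Fin (n - 1)) (Fin (n - 1)) ℝ) (hb : b.IsSymm) :
    ∃ W : Set (Fin (n - 1) → ℝ), IsOpen W ∧ (0 : Fin (n - 1) → ℝ) ∈ W ∧
      ∃ r : (Fin (n - 1) → ℝ) → (Fin n → ℝ),
        ContDiffOn ℝ (⊤ : ℕ∞) r W ∧
        r '' W ⊆ U ∧
        r 0 = p₀ ∧
        (∀ u ∈ W, LinearIndependent ℝ
          (fun i : Fin (n - 1) => fderiv ℝ r u (Pi.single i 1))) ∧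
        (∀ i : Fin (n - 1), fderiv ℝ r 0 (Pi.single i 1) = τ i) ∧
        (∀ i j : Fin (n - 1), b i j =
          ∑ a : Fin n, ∑ c : Fin n, g p₀ a c *
            ((Real.sqrt (gInner (g p₀) v₀ v₀))⁻¹ * v₀ a) *
            (fderiv ℝ (fun u => fderiv ℝ (fun u' => r u' c) u (Pi.single j 1)) 0
                (Pi.single i 1) +
             ∑ d : Fin n, ∑ e : Fin n, christoffel g p₀ c d e * τ i d * τ j e)) := by
  have hsymm_near : ∀ᶠ y in nhds p₀, (g y).IsSymm := Filter.mem_of_superset (hU.mem_nhds hp₀) hsym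
  have hQ : 0 < gInner (g p₀) v₀ v₀ := gInner_self_pos (hpos p₀ hp₀) hv₀
  set Q := gInner (g p₀) v₀ v₀ with hQdef
  set ν : ℝ := (Real.sqrt Q)⁻¹
  have hνpos : 0 < ν := inv_pos.2 (Real.sqrt_pos.2 hQ)
  set Γ : Fin (n - 1) → Fin (n - 1) → Fin n → ℝ := fun i j c =>
    ∑ d : Fin n, ∑ e : Fin n, christoffel g p₀ c d e * τ i d * τ j e with hΓ
  have hΓsymm (i j) : Γ i j = Γ j i := by
    funext c
    simp only [hΓ]
    rw [Finset.sum_comm]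
    refine Finset.sum_congr rfl fun d _ => Finset.sum_congr rfl fun e _ => ?_
    rw [christoffel_comm hsymm_near]
    ring
  set M : Matrix (Fin (n - 1)) (Fin (n - 1)) ℝ := fun i j =>
    (b i j - ν * gInner (g p₀) v₀ (Γ i j)) / (ν * Q) with hM
  have hMsymm (i j) : M i j = M j i := by simp only [hM, hΓsymm i j, hb.apply j i]
  let A : (Fin (n - 1) → ℝ) →L[ℝ] (Fin n → ℝ) :=
    LinearMap.toContinuousLinearMap (Fintype.linearCombination ℝ τ)
  have hA (i) : A (Pi.single i 1) = τ i := by simp [A]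
  let B : (Fin (n - 1) → ℝ) →L[ℝ] (Fin (n - 1) → ℝ) →L[ℝ] ℝ :=
    (Matrix.toLinearMap₂' ℝ M).toContinuousBilinearMap
  have hBapply (x y) : B x y = ∑ i, ∑ j, x i * y j * M i j := by
    simp [B, Matrix.toLinearMap₂'_apply, mul_assoc]
  have hBsingle (i j) : B (Pi.single i 1) (Pi.single j 1) = M i j := by
    simp [hBapply, Pi.single_apply]
  have hB (x y) : B x y = B y x := by
    rw [hBapply, hBapply, Finset.sum_comm]
    refine Finset.sum_congr rfl fun i _ => Finset.sum_congr rfl fun j _ => ?_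
    rw [hMsymm]
    ring
  set r := quadraticMap p₀ v₀ A B with hr
  have hr_smooth : ContDiff ℝ (⊤ : ℕ∞) r := contDiff_quadraticMap p₀ v₀ A B
  have hr_deriv (u w) : fderiv ℝ r u w = A w + B u w • v₀ :=
    fderiv_quadraticMap_apply p₀ v₀ A hB u w
  have hr_zero : r 0 = p₀ := by simp [hr, quadraticMap]
  have hr_tangent (i) : fderiv ℝ r 0 (Pi.single i 1) = τ i := by simp [hr_deriv, hA]
  have hframe : Continuous fun u => fun i : Fin (n - 1) => fderiv ℝ r u (Pi.single i 1) := by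
    simp only [hr_deriv]
    fun_prop
  refine ⟨r ⁻¹' U ∩ {u | LinearIndependent ℝ fun i => fderiv ℝ r u (Pi.single i 1)},
    (hU.preimage hr_smooth.continuous).inter (isOpen_setOfPred_linearIndependent.preimage hframe),
    ⟨by simpa [hr_zero] using hp₀, by simpa [hr_tangent] using hτind⟩, r, hr_smooth.contDiffOn,
    by rintro _ ⟨u, hu, rfl⟩; exact hu.1, hr_zero, fun u hu => hu.2, hr_tangent, fun i j => ?_⟩
  have hsecond (c : Fin n) :
      fderiv ℝ (fun u => fderiv ℝ (fun u' => r u' c) u (Pi.single j 1)) 0 (Pi.single i 1)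
        = M i j * v₀ c := by
    have hcomp (u) : fderiv ℝ (fun u' => r u' c) u (Pi.single j 1)
        = A (Pi.single j 1) c + B u (Pi.single j 1) * v₀ c := by
      rw [fderiv_apply (hr_smooth.differentiable (by simp) u)]
      simp [hr_deriv]
    have h : HasFDerivAt (fun u => A (Pi.single j 1) c + B u (Pi.single j 1) * v₀ c) _ 0 :=
      (((B.flip (Pi.single j 1)).hasFDerivAt).mul_const (v₀ c)).const_add (A (Pi.single j 1) c)
    simp only [hcomp]
    rw [h.fderiv]
    simp [hBsingle, mul_comm]
  have hsum : ∑ a : Fin n, ∑ c : Fin n, g p₀ a c * (ν * v₀ a) * (M i j * v₀ c + Γ i j c)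
      = M i j * (ν * Q) + ν * gInner (g p₀) v₀ (Γ i j) := by
    simp only [hQdef, gInner, Finset.mul_sum, ← Finset.sum_add_distrib]
    exact Finset.sum_congr rfl fun a _ => Finset.sum_congr rfl fun c _ => by ring
  simp only [hsecond]
  rw [hsum]
  have : ν * Q ≠ 0 := (mul_pos hνpos hQ).ne'
  simp only [hM]
  field_simp
  ring
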